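/- The Galilean boost X₅: if (u, ρ, p, s, θ) solves the full Navier–Stokes system on a line, then for any v ∈ ℝ, the shifted functions ũ(t,a) = u(t, a−vt) + v, ρ̃(t,a) = ρ(t, a−vt), p̃(t,a) = p(t, a−vt), s̃(t,a) = s(t, a−vt), θ̃(t,a) = θ(t, a−vt) also solve it. -/

import Mathlib

/-- Partial derivative in the first (time) variable. -/
noncomputable def pdt (f : ℝ → ℝ → ℝ) (t a : ℝ) : ℝ := deriv (fun t' => f t' a) t

/-- Partial derivative in the second (space) variable. -/
noncomputable def pda (f : ℝ → ℝ → ℝ) (t a : ℝ) : ℝ := deriv (fun a' => f t a') a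

/-- Second partial derivative in the space variable. -/
noncomputable def pdaa (f : ℝ → ℝ → ℝ) (t a : ℝ) : ℝ :=
  deriv (fun a' => deriv (fun a'' => f t a'') a') a

/-- The Navier--Stokes system on a curve with `h a = lam * a`. -/
def NavierStokes (ζ κ g lam : ℝ) (u p ρ s θ : ℝ → ℝ → ℝ) : Prop :=
  ∀ t a : ℝ,
    (ρ t a * (pdt u t a + u t a * pda u t a) + pda p t a
        - ζ * pdaa u t a - ρ t a * g * lam = 0) ∧
    (pdt ρ t a + pda (fun t' a' => ρ t' a' * u t' a') t a = 0) ∧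
    (ρ t a * θ t a * (pdt s t a + u t a * pda s t a)
        - κ * pdaa θ t a - ζ * (pda u t a)^2 = 0)

/-- A jointly differentiable function is differentiable in the space variable. -/
theorem differentiableAt_space {f : ℝ → ℝ → ℝ}
    (hf : Differentiable ℝ (fun q : ℝ × ℝ => f q.1 q.2)) (t a : ℝ) :
    DifferentiableAt ℝ (fun a' => f t a') a :=
  (hf (t, a)).comp a (f := fun a' : ℝ => (t, a')) (by fun_prop)

/-- Time derivative of a function seen in a frame moving with velocity `v`. -/
theorem pdt_boost {f : ℝ → ℝ → ℝ}
    (hf : Differentiable ℝ (fun q : ℝ × ℝ => f q.1 q.2)) (v t a : ℝ) :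
    pdt (fun t a => f t (a - v * t)) t a
      = pdt f t (a - v * t) - v * pda f t (a - v * t) := by
  set b := a - v * t with hb
  have hF := (hf (t, b)).hasFDerivAt
  set L := fderiv ℝ (fun q : ℝ × ℝ => f q.1 q.2) (t, b)
  have ht : HasDerivAt (fun t' => f t' b) (L (1, 0)) t :=
    hF.comp_hasDerivAt (f := fun t' : ℝ => (t', b)) t
      ((hasDerivAt_id t).prodMk (hasDerivAt_const t b))
  have ha : HasDerivAt (fun a' => f t a') (L (0, 1)) b :=
    hF.comp_hasDerivAt (f := fun a' : ℝ => (t, a')) b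
      ((hasDerivAt_const b t).prodMk (hasDerivAt_id b))
  have hγ : HasDerivAt (fun t' : ℝ => (t', a - v * t')) (1, -v) t := by
    simpa using (hasDerivAt_id t).prodMk (((hasDerivAt_id t).const_mul v).const_sub a)
  have hc : HasDerivAt (fun t' => f t' (a - v * t')) (L (1, -v)) t :=
    hF.comp_hasDerivAt (f := fun t' : ℝ => (t', a - v * t')) t hγ
  have hL : L (1, -v) = L (1, 0) - v * L (0, 1) := by
    rw [← smul_eq_mul, ← map_smul, ← map_sub]
    simp
  simp only [pdt, pda]
  rw [hc.deriv, ht.deriv, ha.deriv, hL]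

/-- Space derivatives commute with passing to a moving frame. -/
theorem pda_boost (f : ℝ → ℝ → ℝ) (v t a : ℝ) :
    pda (fun t a => f t (a - v * t)) t a = pda f t (a - v * t) :=
  deriv_comp_sub_const (f := f t) (v * t) a

/-- Second space derivatives commute with passing to a moving frame. -/
theorem pdaa_boost (f : ℝ → ℝ → ℝ) (v t a : ℝ) :
    pdaa (fun t a => f t (a - v * t)) t a = pdaa f t (a - v * t) := by
  simp only [pdaa, deriv_comp_sub_const (f := f t)]
  exact deriv_comp_sub_const (f := deriv (f t)) (v * t) a

theorem pdt_add_const (f : ℝ → ℝ → ℝ) (c t a : ℝ) :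
    pdt (fun t a => f t a + c) t a = pdt f t a :=
  deriv_add_const c

theorem pda_add_const (f : ℝ → ℝ → ℝ) (c t a : ℝ) :
    pda (fun t a => f t a + c) t a = pda f t a :=
  deriv_add_const c

theorem pdaa_add_const (f : ℝ → ℝ → ℝ) (c t a : ℝ) :
    pdaa (fun t a => f t a + c) t a = pdaa f t a := by
  simp only [pdaa, deriv_add_const]

theorem galilean_boost (ζ κ g lam : ℝ) (u p ρ s θ : ℝ → ℝ → ℝ)
    (hu : ContDiff ℝ 2 (fun q : ℝ × ℝ => u q.1 q.2))
    (hp : ContDiff ℝ 2 (fun q : ℝ × ℝ => p q.1 q.2))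
    (hρ : ContDiff ℝ 2 (fun q : ℝ × ℝ => ρ q.1 q.2))
    (hs : ContDiff ℝ 2 (fun q : ℝ × ℝ => s q.1 q.2))
    (hθ : ContDiff ℝ 2 (fun q : ℝ × ℝ => θ q.1 q.2))
    (hNS : NavierStokes ζ κ g lam u p ρ s θ) (v : ℝ) :
    NavierStokes ζ κ g lam
      (fun t a => u t (a - v*t) + v)
      (fun t a => p t (a - v*t))
      (fun t a => ρ t (a - v*t))
      (fun t a => s t (a - v*t))
      (fun t a => θ t (a - v*t)) := by
  have du := hu.differentiable two_ne_zero
  have dρ := hρ.differentiable two_ne_zero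
  have ds := hs.differentiable two_ne_zero
  intro t a
  obtain ⟨h1, h2, h3⟩ := hNS t (a - v * t)
  have hut : pdt (fun t a => u t (a - v * t) + v) t a
      = pdt u t (a - v * t) - v * pda u t (a - v * t) :=
    (pdt_add_const (fun t a => u t (a - v * t)) v t a).trans (pdt_boost du v t a)
  have hua : pda (fun t a => u t (a - v * t) + v) t a = pda u t (a - v * t) :=
    (pda_add_const (fun t a => u t (a - v * t)) v t a).trans (pda_boost u v t a)
  have huaa : pdaa (fun t a => u t (a - v * t) + v) t a = pdaa u t (a - v * t) :=
    (pdaa_add_const (fun t a => u t (a - v * t)) v t a).trans (pdaa_boost u v t a)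
  have hflux : pda (fun t a => ρ t (a - v * t) * (u t (a - v * t) + v)) t a
      = pda (fun t a => ρ t a * u t a) t (a - v * t) + v * pda ρ t (a - v * t) := by
    have hρa := differentiableAt_space dρ t (a - v * t)
    have hud := differentiableAt_space du t (a - v * t)
    rw [pda_boost (fun t a => ρ t a * (u t a + v))]
    simp only [pda, mul_add]
    rw [deriv_fun_add (hρa.fun_mul hud) (hρa.mul_const v), deriv_mul_const hρa,
      mul_comm v (deriv _ _)]
  refine ⟨?_, ?_, ?_⟩
  · rw [hut, hua, huaa, pda_boost p]
    linear_combination h1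
  · rw [pdt_boost dρ, hflux]
    linear_combination h2
  · rw [hua, pdt_boost ds, pda_boost s, pdaa_boost θ]
    linear_combination h3
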